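/- Let d ∈ ℕ and let V : ℝ^d → ℝ be Borel measurable. Define f(t) = sup_{x,y∈ℝ^d} S(V,t,x,y) ∈ [0,∞] for t > 0. Then f is sub-additive: f(t₁ + t₂) ≤ f(t₁) + f(t₂) for all t₁, t₂ > 0. -/

import Mathlib

open MeasureTheory Real
open scoped ENNReal

/-- The Gauss–Weierstrass kernel on `ℝ^d`. -/
noncomputable def gk (d : ℕ) (t : ℝ) (x y : EuclideanSpace ℝ (Fin d)) : ℝ :=
  (4 * Real.pi * t) ^ (-(d : ℝ) / 2) * Real.exp (-‖y - x‖ ^ 2 / (4 * t))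

/-- `S(V,t,x,y)`, the potential of `|V|` for the Gaussian bridges. -/
noncomputable def Sv (d : ℕ) (V : EuclideanSpace ℝ (Fin d) → ℝ) (t : ℝ)
    (x y : EuclideanSpace ℝ (Fin d)) : ℝ≥0∞ :=
  ∫⁻ s in Set.Ioo 0 t, ∫⁻ z,
    ENNReal.ofReal (gk d s x z * gk d (t - s) z y / gk d t x y * |V z|)

/-- `f(t) = sup_{x,y} S(V,t,x,y)`. -/
noncomputable def fS (d : ℕ) (V : EuclideanSpace ℝ (Fin d) → ℝ) (t : ℝ) : ℝ≥0∞ :=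
  ⨆ (x : EuclideanSpace ℝ (Fin d)) (y : EuclideanSpace ℝ (Fin d)), Sv d V t x y

/-- The Gaussian kernel is positive at positive times. -/
lemma gk_pos (d : ℕ) {t : ℝ} (ht : 0 < t) (x y : EuclideanSpace ℝ (Fin d)) : 0 < gk d t x y := by
  unfold gk; positivity

lemma gk_symm (d : ℕ) (t : ℝ) (x y : EuclideanSpace ℝ (Fin d)) : gk d t x y = gk d t y x := by
  unfold gk; rw [norm_sub_rev]

lemma measurable_gk (d : ℕ) :
    Measurable fun p : ℝ × EuclideanSpace ℝ (Fin d) × EuclideanSpace ℝ (Fin d) =>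
      gk d p.1 p.2.1 p.2.2 := by
  unfold gk; fun_prop

lemma Measurable.ofReal_gk {d : ℕ} {α : Type*} [MeasurableSpace α] {f : α → ℝ}
    {g h : α → EuclideanSpace ℝ (Fin d)} (hf : Measurable f) (hg : Measurable g)
    (hh : Measurable h) : Measurable fun a => ENNReal.ofReal (gk d (f a) (g a) (h a)) :=
  ((measurable_gk d).comp (hf.prodMk (hg.prodMk hh))).ennreal_ofReal

lemma integral_gk (d : ℕ) {t : ℝ} (ht : 0 < t) (x : EuclideanSpace ℝ (Fin d)) :
    ∫ y, gk d t x y = 1 := by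
  have h := GaussianFourier.integral_rexp_neg_mul_sq_norm
    (V := EuclideanSpace ℝ (Fin d)) (b := 1 / (4 * t)) (by positivity)
  unfold gk
  rw [integral_const_mul,
    integral_sub_right_eq_self (fun y : EuclideanSpace ℝ (Fin d) =>
      Real.exp (-‖y‖ ^ 2 / (4 * t))) x]
  have h' : ∀ y : EuclideanSpace ℝ (Fin d),
      -‖y‖ ^ 2 / (4 * t) = -(1 / (4 * t)) * ‖y‖ ^ 2 := fun y => by ring
  simp_rw [h']
  rw [h, finrank_euclideanSpace_fin, neg_div, Real.rpow_neg (by positivity),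
    show π / (1 / (4 * t)) = 4 * π * t by field_simp]
  exact inv_mul_cancel₀ (by positivity)

lemma lintegral_gk (d : ℕ) {t : ℝ} (ht : 0 < t) (x : EuclideanSpace ℝ (Fin d)) :
    ∫⁻ y, ENNReal.ofReal (gk d t x y) = 1 := by
  rw [← ofReal_integral_eq_lintegral_ofReal (integrable_of_integral_eq_one (integral_gk d ht x))
    (.of_forall fun y => (gk_pos d ht x y).le), integral_gk d ht x, ENNReal.ofReal_one]

/-- Completing the square in a product of two Gaussian kernels. -/
lemma gk_mul_gk (d : ℕ) {a b : ℝ} (ha : 0 < a) (hb : 0 < b)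
    (x w y : EuclideanSpace ℝ (Fin d)) :
    gk d a x w * gk d b w y =
      gk d (a + b) x y * gk d (a * b / (a + b)) (x + (a / (a + b)) • (y - x)) w := by
  unfold gk
  rw [mul_mul_mul_comm ((4 * π * a) ^ _), mul_mul_mul_comm ((4 * π * (a + b)) ^ _),
    ← Real.exp_add, ← Real.exp_add,
    ← Real.mul_rpow (by positivity) (by positivity),
    ← Real.mul_rpow (by positivity) (by positivity)]
  congr 2
  · field_simp
  · have h₁ : y - w = (y - x) - (w - x) := by abel
    have h₂ : w - (x + (a / (a + b)) • (y - x)) = (w - x) - (a / (a + b)) • (y - x) := by abel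
    rw [h₁, h₂, norm_sub_sq_real (y - x), norm_sub_sq_real (w - x) (_ • _), inner_smul_right, norm_smul, mul_pow,
      Real.norm_eq_abs, sq_abs, real_inner_comm (w - x) (y - x)]
    field_simp
    ring

/-- The Chapman–Kolmogorov equation. -/
lemma lintegral_gk_mul_gk (d : ℕ) {a b : ℝ} (ha : 0 < a) (hb : 0 < b)
    (x y : EuclideanSpace ℝ (Fin d)) :
    ∫⁻ w, ENNReal.ofReal (gk d a x w) * ENNReal.ofReal (gk d b w y) =
      ENNReal.ofReal (gk d (a + b) x y) := by
  have h : ∀ w, ENNReal.ofReal (gk d a x w) * ENNReal.ofReal (gk d b w y) =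
      ENNReal.ofReal (gk d (a + b) x y) *
        ENNReal.ofReal (gk d (a * b / (a + b)) (x + (a / (a + b)) • (y - x)) w) := fun w => by
    rw [← ENNReal.ofReal_mul (gk_pos d ha x w).le, gk_mul_gk d ha hb,
      ENNReal.ofReal_mul (gk_pos d (by positivity) x y).le]
  simp_rw [h]
  rw [lintegral_const_mul' _ _ ENNReal.ofReal_ne_top, lintegral_gk d (by positivity), mul_one]

lemma ofReal_gk_mul_Sv (d : ℕ) (V : EuclideanSpace ℝ (Fin d) → ℝ) {t : ℝ} (ht : 0 < t)
    (x y : EuclideanSpace ℝ (Fin d)) :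
    ENNReal.ofReal (gk d t x y) * Sv d V t x y =
      ∫⁻ s in Set.Ioo 0 t, ∫⁻ z, ENNReal.ofReal (gk d s x z) *
        ENNReal.ofReal (gk d (t - s) z y) * ENNReal.ofReal |V z| := by
  unfold Sv
  rw [← lintegral_const_mul' _ _ ENNReal.ofReal_ne_top]
  refine setLIntegral_congr_fun measurableSet_Ioo fun s hs => ?_
  rw [← lintegral_const_mul' _ _ ENNReal.ofReal_ne_top]
  refine lintegral_congr fun z => ?_
  have h₀ := gk_pos d ht x y
  have h₁ := gk_pos d hs.1 x z
  have h₂ := gk_pos d (sub_pos.2 hs.2) z y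
  rw [← ENNReal.ofReal_mul h₀.le, ← ENNReal.ofReal_mul h₁.le,
    ← ENNReal.ofReal_mul (by positivity)]
  congr 1
  field_simp

lemma lintegral_lintegral_lintegral_rotate {α β γ : Type*} [MeasurableSpace α]
    [MeasurableSpace β] [MeasurableSpace γ] {μ : Measure α} {ν : Measure β} {ρ : Measure γ}
    [SFinite μ] [SFinite ν] [SFinite ρ] {f : α → β → γ → ℝ≥0∞}
    (hf : Measurable fun p : (α × γ) × β => f p.1.1 p.2 p.1.2) :
    ∫⁻ a, ∫⁻ b, ∫⁻ c, f a b c ∂ρ ∂ν ∂μ = ∫⁻ c, ∫⁻ a, ∫⁻ b, f a b c ∂ν ∂μ ∂ρ := by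
  refine Eq.trans (lintegral_congr fun a => lintegral_lintegral_swap
    (Measurable.aemeasurable ?_)) (lintegral_lintegral_swap hf.lintegral_prod_right'.aemeasurable)
  have ha : Measurable fun q : β × γ => ((a, q.2), q.1) := by fun_prop
  exact hf.comp ha

/-- The contribution of the times before `a` to the potential of the bridge of length `a + b`. -/
lemma setLIntegral_Ioo_gk_le (d : ℕ) (V : EuclideanSpace ℝ (Fin d) → ℝ) (hV : Measurable V)
    {a b : ℝ} (ha : 0 < a) (hb : 0 < b) (x y : EuclideanSpace ℝ (Fin d)) :
    ∫⁻ s in Set.Ioo 0 a, ∫⁻ z, ENNReal.ofReal (gk d s x z) *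
        ENNReal.ofReal (gk d (a + b - s) z y) * ENNReal.ofReal |V z| ≤
      ENNReal.ofReal (gk d (a + b) x y) * fS d V a := by
  have hv : Measurable fun z => ENNReal.ofReal |V z| := hV.abs.ennreal_ofReal
  calc
    _ = ∫⁻ s in Set.Ioo 0 a, ∫⁻ z, ∫⁻ w, ENNReal.ofReal (gk d b w y) *
        (ENNReal.ofReal (gk d s x z) * ENNReal.ofReal (gk d (a - s) z w) *
          ENNReal.ofReal |V z|) := by
      refine setLIntegral_congr_fun measurableSet_Ioo fun s hs => lintegral_congr fun z => ?_
      have h : ∀ w, ENNReal.ofReal (gk d b w y) * (ENNReal.ofReal (gk d s x z) *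
          ENNReal.ofReal (gk d (a - s) z w) * ENNReal.ofReal |V z|) =
          (ENNReal.ofReal (gk d s x z) * ENNReal.ofReal |V z|) *
          (ENNReal.ofReal (gk d (a - s) z w) * ENNReal.ofReal (gk d b w y)) :=
        fun w => by ring
      simp_rw [h]
      rw [lintegral_const_mul' _ _ (ENNReal.mul_ne_top ENNReal.ofReal_ne_top
          ENNReal.ofReal_ne_top), lintegral_gk_mul_gk d (sub_pos.2 hs.2) hb,
        show a - s + b = a + b - s by ring]
      ring
    _ = ∫⁻ w, ∫⁻ s in Set.Ioo 0 a, ∫⁻ z, ENNReal.ofReal (gk d b w y) *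
        (ENNReal.ofReal (gk d s x z) * ENNReal.ofReal (gk d (a - s) z w) *
          ENNReal.ofReal |V z|) := by
      refine lintegral_lintegral_lintegral_rotate ?_
      exact (Measurable.ofReal_gk (by fun_prop) (by fun_prop) (by fun_prop)).mul
        (((Measurable.ofReal_gk (by fun_prop) (by fun_prop) (by fun_prop)).mul
          (Measurable.ofReal_gk (by fun_prop) (by fun_prop) (by fun_prop))).mul
          (hv.comp measurable_snd))
    _ = ∫⁻ w, ENNReal.ofReal (gk d b w y) * (ENNReal.ofReal (gk d a x w) * Sv d V a x w) := by
      refine lintegral_congr fun w => ?_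
      simp only [lintegral_const_mul' _ _ ENNReal.ofReal_ne_top]
      rw [ofReal_gk_mul_Sv d V ha]
    _ ≤ ∫⁻ w, (ENNReal.ofReal (gk d a x w) * ENNReal.ofReal (gk d b w y)) * fS d V a := by
      refine lintegral_mono fun w => ?_
      rw [← mul_assoc, mul_comm (ENNReal.ofReal (gk d b w y))]
      gcongr
      exact le_iSup₂ (f := fun x y => Sv d V a x y) x w
    _ = _ := by
      have hm : Measurable fun w => ENNReal.ofReal (gk d a x w) * ENNReal.ofReal (gk d b w y) :=
        (Measurable.ofReal_gk (by fun_prop) (by fun_prop) (by fun_prop)).mul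
          (Measurable.ofReal_gk (by fun_prop) (by fun_prop) (by fun_prop))
      rw [lintegral_mul_const _ hm, lintegral_gk_mul_gk d ha hb]

lemma setLIntegral_Ioo_comp_sub_left (f : ℝ → ℝ≥0∞) (a b : ℝ) :
    ∫⁻ s in Set.Ioo a (a + b), f s = ∫⁻ s in Set.Ioo 0 b, f (a + b - s) := by
  have h := (Measure.measurePreserving_sub_left volume (a + b)).setLIntegral_comp_preimage_emb
    (MeasurableEquiv.subLeft (a + b)).measurableEmbedding f (Set.Ioo a (a + b))
  rw [← h]
  simp

theorem fS_subadditive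
    (d : ℕ) (V : EuclideanSpace ℝ (Fin d) → ℝ) (hV : Measurable V) :
    ∀ t₁ t₂ : ℝ, 0 < t₁ → 0 < t₂ →
      fS d V (t₁ + t₂) ≤ fS d V t₁ + fS d V t₂ := by
  intro a b ha hb
  refine iSup₂_le fun x y => ?_
  have hab : 0 < a + b := add_pos ha hb
  have hg : ENNReal.ofReal (gk d (a + b) x y) ≠ 0 :=
    (ENNReal.ofReal_pos.2 (gk_pos d hab x y)).ne'
  rw [← ENNReal.mul_le_mul_iff_right hg ENNReal.ofReal_ne_top, ofReal_gk_mul_Sv d V hab, mul_add]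
  have hsub : Set.Ioo 0 (a + b) =ᵐ[volume] (Set.Ioo 0 a ∪ Set.Ioo a (a + b) : Set ℝ) := by
    rw [← Set.Ioc_union_Ioo_eq_Ioo ha.le (by linarith)]
    exact Ioo_ae_eq_Ioc.symm.union .rfl
  rw [setLIntegral_congr hsub]
  refine (lintegral_union_le _ _ _).trans
    (add_le_add (setLIntegral_Ioo_gk_le d V hV ha hb x y) ?_)
  rw [setLIntegral_Ioo_comp_sub_left, gk_symm, add_comm a b]
  refine le_trans (le_of_eq ?_) (setLIntegral_Ioo_gk_le d V hV hb ha y x)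
  refine lintegral_congr fun s => lintegral_congr fun z => ?_
  rw [sub_sub_cancel, gk_symm d _ x z, gk_symm d s z y,
    mul_comm (ENNReal.ofReal (gk d (b + a - s) z x))]
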